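/- Let 𝒞 be an abelian category and let X be an artinian object of 𝒞 (every descending chain of subobjects of X is stationary). Then any quotient object and any subobject of X taken in the category Pro(𝒞) of pro-objects of 𝒞 is isomorphic to an object of 𝒞. -/

import Mathlib

/-!
STATEMENT 0: Let 𝒞 be an abelian category and `X` an artinian object of 𝒞.  Then any
quotient object and any subobject of `X` taken in `Pro(𝒞)` is isomorphic to an object of 𝒞.

`Pro(𝒞)` is axiomatized by `IsProCategory`: an abelian category `P` together with a fully
faithful exact embedding `ι : C ⥤ P` such that every object of `P` is a small cofiltered
limit of objects of `C`, satisfying the defining hom-property of pro-objects.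
-/

open CategoryTheory CategoryTheory.Limits

universe v u v₂ u₂

namespace Paper

variable {C : Type u} [Category.{v} C] {P : Type u₂} [Category.{v₂} P]

/-- A presentation of `X : P` as a small cofiltered limit of objects of `C`, together with
the defining hom-property of pro-objects: `Hom_P(X, ιY) ≅ colimᵢ Hom_C(Dᵢ, Y)`. -/
structure ProPresentation (ι : C ⥤ P) (X : P) where
  I : Type v₂
  [instCat : SmallCategory I]
  [instCof : IsCofiltered I]
  D : I ⥤ C
  π : (Functor.const I).obj X ⟶ D ⋙ ι
  isLimit : IsLimit (Cone.mk X π)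
  hom_lift : ∀ (Y : C) (g : X ⟶ ι.obj Y), ∃ (i : I) (h : D.obj i ⟶ Y), g = π.app i ≫ ι.map h
  hom_eq : ∀ (Y : C) (i : I) (h h' : D.obj i ⟶ Y),
      π.app i ≫ ι.map h = π.app i ≫ ι.map h' →
      ∃ (j : I) (u : j ⟶ i), D.map u ≫ h = D.map u ≫ h'

/-- `ι : C ⥤ P` realizes `P` as the category of pro-objects of `C`. -/
structure IsProCategory (ι : C ⥤ P) : Prop where
  full : ι.Full
  faithful : ι.Faithful
  pres : ∀ X : P, Nonempty (ProPresentation ι X)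

/-- Two epimorphisms out of the same object of an abelian category, each of which kills the
kernel of the other, have isomorphic targets. -/
theorem nonempty_iso_of_epi_of_kernel_comp_eq_zero [Abelian C] {A B B' : C} (p : A ⟶ B)
    (q : A ⟶ B') [Epi p] [Epi q] (hpq : kernel.ι p ≫ q = 0) (hqp : kernel.ι q ≫ p = 0) :
    Nonempty (B ≅ B') :=
  ⟨{ hom := Abelian.epiDesc p q hpq
     inv := Abelian.epiDesc q p hqp
     hom_inv_id := by simp [← cancel_epi p]
     inv_hom_id := by simp [← cancel_epi q] }⟩

/-- Among the components of a cone with artinian apex over a nonempty cofiltered diagram, some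
component has the smallest kernel. -/
theorem exists_component_comp_eq_zero_imp [Abelian C] {X : C} [IsArtinianObject X]
    {I : Type*} [Category* I] [IsCofiltered I] {D : I ⥤ C}
    (c : (Functor.const I).obj X ⟶ D) :
    ∃ i, ∀ j {W : C} (h : W ⟶ X), h ≫ c.app i = 0 → h ≫ c.app j = 0 := by
  let K : I → Subobject X := fun i => kernelSubobject (c.app i)
  have K_mono : ∀ {i j : I}, (i ⟶ j) → K i ≤ K j := fun {i j} u => by
    refine le_kernelSubobject (c.app j) _ ?_
    have hu : c.app j = c.app i ≫ D.map u := by simpa using c.naturality u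
    rw [hu, ← Category.assoc]
    simp [K, kernelSubobject_arrow_comp]
  obtain ⟨_, ⟨i, rfl⟩, hi⟩ := (wellFounded_lt (α := Subobject X)).has_min (Set.range K)
    ⟨_, IsCofiltered.nonempty.some, rfl⟩
  refine ⟨i, fun j W h hh => ?_⟩
  have hle : K i ≤ K j := by
    have hmin : K (IsCofiltered.min i j) = K i :=
      (K_mono (IsCofiltered.minToLeft i j)).eq_of_not_lt (hi _ ⟨_, rfl⟩)
    exact hmin ▸ K_mono (IsCofiltered.minToRight i j)
  exact (kernelSubobject_factors_iff _ _).1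
    (Subobject.factors_of_le h hle ((kernelSubobject_factors_iff _ _).2 hh))

/-- A quotient in `P` of an artinian object of `C` lies in the essential image of `C`. -/
theorem exists_iso_of_epi [Abelian C] [Abelian P] (ι : C ⥤ P) [ι.Full] [ι.Faithful]
    [PreservesFiniteLimits ι] [PreservesFiniteColimits ι]
    {X : C} [IsArtinianObject X] {Y : P} (pres : ProPresentation ι Y) (g : ι.obj X ⟶ Y) [Epi g] :
    ∃ Z : C, Nonempty (Y ≅ ι.obj Z) := by
  let := pres.instCat
  have := pres.instCof
  let c : (Functor.const pres.I).obj X ⟶ pres.D :=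
    { app := fun i => ι.preimage (g ≫ pres.π.app i)
      naturality := fun i j u => ι.map_injective (by
        have hu := pres.π.naturality u
        simp only [Functor.const_obj_obj, Functor.const_obj_map, Category.id_comp,
          Functor.comp_obj, Functor.comp_map] at hu
        simp [hu]) }
  have hc : ∀ i, ι.map (c.app i) = g ≫ pres.π.app i := fun i => ι.map_preimage _
  obtain ⟨i, hi⟩ := exists_component_comp_eq_zero_imp c
  let e := Abelian.factorThruImage (c.app i)
  let m := Abelian.image.ι (c.app i)
  have hem : e ≫ m = c.app i := Abelian.image.fac _
  refine ⟨_, nonempty_iso_of_epi_of_kernel_comp_eq_zero g (ι.map e) ?_ ?_⟩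
  · rw [← cancel_mono (ι.map m), Category.assoc, ← ι.map_comp, hem, hc]
    simp
  · refine pres.isLimit.hom_ext fun j => ?_
    have hj : kernel.ι e ≫ c.app j = 0 := 
      hi j _ ((whisker_eq (kernel.ι e) hem).symm.trans (by simp))
    change (kernel.ι (ι.map e) ≫ g) ≫ pres.π.app j = 0 ≫ pres.π.app j
    rw [Category.assoc, ← hc, ← Abelian.comp_epiDesc e (c.app j) hj, ι.map_comp]
    simp

/-- If `X` is an artinian object of the abelian category `C`, then every
subobject and every quotient object of `X` in `Pro(C)` is isomorphic to an object of `C`. -/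
theorem statement_0
    [Abelian C] [Abelian P]
    (ι : C ⥤ P) [ι.Additive] [PreservesFiniteLimits ι] [PreservesFiniteColimits ι]
    (hPro : IsProCategory ι)
    (X : C) (hX : IsArtinianObject X) :
    (∀ (Y : P) (f : Y ⟶ ι.obj X), Mono f → ∃ Z : C, Nonempty (Y ≅ ι.obj Z)) ∧
    (∀ (Y : P) (g : ι.obj X ⟶ Y), Epi g → ∃ Z : C, Nonempty (Y ≅ ι.obj Z)) := by
  have := hPro.full
  have := hPro.faithful
  have quot : ∀ (Y : P) (g : ι.obj X ⟶ Y), Epi g → ∃ Z : C, Nonempty (Y ≅ ι.obj Z) :=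
    fun Y g _ => exists_iso_of_epi ι (hPro.pres Y).some g
  refine ⟨fun Y f _ => ?_, quot⟩
  obtain ⟨Z, ⟨φ⟩⟩ := quot _ (cokernel.π f) inferInstance
  let q : X ⟶ Z := ι.preimage (cokernel.π f ≫ φ.hom)
  have hq : ι.map q = cokernel.π f ≫ φ.hom := ι.map_preimage _
  let isKernel := Abelian.monoIsKernelOfCokernel _ (cokernelIsCokernel f)
  exact ⟨kernel q, ⟨isKernel.conePointUniqueUpToIso (kernelIsKernel (cokernel.π f)) ≪≫
    (kernelCompMono _ φ.hom).symm ≪≫ kernelIsoOfEq hq.symm ≪≫ (PreservesKernel.iso ι q).symm⟩⟩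

end Paper
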